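/- Let G be a geometrically finite discrete convergence group acting on a compact metrizable space M, let H be a subgroup of G, and let J₁, J₂ ≤ H be fully quasi-convex subgroups of G. Let U₁, U₂ be open subsets of M such that, for i ∈ {1,2}, U_i is J_i-invariant and Λ(H) ∖ Λ(J_i) ⊆ U_i. Suppose that for every g ∈ H ∖ J₂, g(M ∖ U₂) ⊆ U₁. Then there exists a compact set K ⊆ U₁ such that for all g ∈ H ∖ J₂ there is j ∈ J₁ with j g (M ∖ U₂) ⊆ K. -/

import Mathlib

open Filter Topology Set

namespace ConvergenceGroups

variable {M : Type*} [TopologicalSpace M]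

/-- The group of self-homeomorphisms of `M`, with `(g * h) x = g (h x)`. -/
instance : Group (M ≃ₜ M) where
  mul g h := h.trans g
  one := Homeomorph.refl M
  inv := Homeomorph.symm
  mul_assoc _ _ _ := rfl
  one_mul _ := Homeomorph.ext fun _ => rfl
  mul_one _ := Homeomorph.ext fun _ => rfl
  inv_mul_cancel g := Homeomorph.ext fun x => g.symm_apply_apply x

/-- The inclusion of the self-homeomorphisms of `M` into the continuous self-maps of `M`;
the latter carries the compact-open topology. -/
def toCM (g : M ≃ₜ M) : C(M, M) := ⟨⇑g, g.continuous⟩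

/-- `(g k)` is a convergence sequence with attracting point `zp` and repelling point `zm`:
the maps `g k` converge to the constant map `zp` uniformly on compact subsets of
`M ∖ {zm}`. -/
def IsConvSeq (g : ℕ → M ≃ₜ M) (zp zm : M) : Prop :=
  ∀ K : Set M, IsCompact K → zm ∉ K → ∀ U ∈ 𝓝 zp,
    ∀ᶠ k in atTop, ∀ x ∈ K, g k x ∈ U

/-- `(g k)` converges in the compact-open topology to a homeomorphism. -/
def TendstoHomeo (g : ℕ → M ≃ₜ M) : Prop :=
  ∃ h : M ≃ₜ M, Tendsto (fun k => toCM (g k)) atTop (𝓝 (toCM h))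

/-- `G` acts on `M` as a convergence group: every sequence of pairwise distinct elements of
`G` has a subsequence which either converges in the compact-open topology to a
homeomorphism, or is a convergence sequence. -/
def IsConvGroup (G : Subgroup (M ≃ₜ M)) : Prop :=
  ∀ g : ℕ → M ≃ₜ M, (∀ k, g k ∈ G) → Function.Injective g →
    ∃ φ : ℕ → ℕ, StrictMono φ ∧
      (TendstoHomeo (g ∘ φ) ∨ ∃ zp zm : M, IsConvSeq (g ∘ φ) zp zm)

/-- `G` acts on `M` as a discrete convergence group: every sequence of pairwise distinct
elements of `G` has a subsequence which is a convergence sequence. -/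
def IsDiscreteConvGroup (G : Subgroup (M ≃ₜ M)) : Prop :=
  ∀ g : ℕ → M ≃ₜ M, (∀ k, g k ∈ G) → Function.Injective g →
    ∃ φ : ℕ → ℕ, StrictMono φ ∧ ∃ zp zm : M, IsConvSeq (g ∘ φ) zp zm

/-- The limit set `Λ(G)`: the set of all attracting points of convergence sequences in `G`. -/
def limitSet (G : Subgroup (M ≃ₜ M)) : Set M :=
  {zp | ∃ g : ℕ → M ≃ₜ M, (∀ k, g k ∈ G) ∧ Function.Injective g ∧
    ∃ zm : M, IsConvSeq g zp zm}

/-- `x` is a conical limit point for `G`: there is a sequence of pairwise distinct elements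
`g k` of `G` such that for every `z ≠ x` the pairs `(g k x, g k z)` remain in a compact
subset of `(M × M) ∖ Δ`. -/
def IsConicalLimitPt (G : Subgroup (M ≃ₜ M)) (x : M) : Prop :=
  ∃ g : ℕ → M ≃ₜ M, (∀ k, g k ∈ G) ∧ Function.Injective g ∧
    ∀ z : M, z ≠ x → ∃ K : Set (M × M), IsCompact K ∧ (∀ p ∈ K, p.1 ≠ p.2) ∧
      ∀ k, (g k x, g k z) ∈ K

/-- `g` is elliptic: the closure of the cyclic group generated by `g` is compact in
`Homeo(M)` (viewed inside `C(M, M)` with the compact-open topology). -/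
def IsEllipticElem (g : M ≃ₜ M) : Prop :=
  IsCompact (closure (Set.range fun n : ℤ => toCM (g ^ n))) ∧
    closure (Set.range fun n : ℤ => toCM (g ^ n)) ⊆ Set.range (toCM (M := M))

/-- `g` is parabolic: not elliptic, and fixes exactly one point of `M`. -/
def IsParabolicElem (g : M ≃ₜ M) : Prop :=
  ¬IsEllipticElem g ∧ ∃! x : M, g x = x

/-- `g` is loxodromic: not elliptic, and fixes exactly two points of `M`. -/
def IsLoxodromicElem (g : M ≃ₜ M) : Prop :=
  ¬IsEllipticElem g ∧ ∃ a b : M, a ≠ b ∧ {x : M | g x = x} = {a, b}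

/-- `p` is a parabolic point for `G`: it is the fixed point of a parabolic element of `G`. -/
def IsParabolicPt (G : Subgroup (M ≃ₜ M)) (p : M) : Prop :=
  ∃ g ∈ G, IsParabolicElem g ∧ g p = p

/-- `p` is a bounded parabolic point for `G`: it is a parabolic point and the quotient of
`Λ(G) ∖ {p}` by the stabilizer of `p` in `G` is compact. -/
def IsBoundedParabolicPt (G : Subgroup (M ≃ₜ M)) (p : M) : Prop :=
  IsParabolicPt G p ∧
    ∃ K : Set M, IsCompact K ∧ K ⊆ limitSet G \ {p} ∧
      ∀ x ∈ limitSet G \ {p}, ∃ h ∈ G, h p = p ∧ h x ∈ K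

/-- `G` is geometrically finite: every point of `Λ(G)` is a conical limit point or a
bounded parabolic point. -/
def IsGeomFinite (G : Subgroup (M ≃ₜ M)) : Prop :=
  ∀ x ∈ limitSet G, IsConicalLimitPt G x ∨ IsBoundedParabolicPt G x

/-- `J` is a fully quasi-convex subgroup of `G`: `J ≤ G`, `J` acts geometrically finitely,
and `g Λ(J) ∩ Λ(J) = ∅` for all but finitely many left cosets `gJ`. -/
def IsFullyQuasiconvex (G J : Subgroup (M ≃ₜ M)) : Prop :=
  J ≤ G ∧ IsGeomFinite J ∧
    ∃ F : Set (M ≃ₜ M), F.Finite ∧ ∀ g ∈ G,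
      (⇑g '' limitSet J ∩ limitSet J).Nonempty → ∃ f ∈ F, ∃ j ∈ J, g = f * j

/-- `G₁` and `G₂` are in AFP ping-pong position with respect to `J = G₁ ∩ G₂`, witnessed by
the closed sets `B₁`, `B₂`. -/
structure AFPPingPong (G₁ G₂ J : Subgroup (M ≃ₜ M)) (B₁ B₂ : Set M) : Prop where
  isClosed₁ : IsClosed B₁
  isClosed₂ : IsClosed B₂
  int_nonempty₁ : (interior B₁).Nonempty
  int_nonempty₂ : (interior B₂).Nonempty
  int_disjoint : interior B₁ ∩ interior B₂ = ∅
  inv₁ : ∀ j ∈ J, ⇑j '' B₁ = B₁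
  inv₂ : ∀ j ∈ J, ⇑j '' B₂ = B₂
  pp₁ : ∀ g ∈ G₁, g ∉ J → ⇑g '' B₁ ⊆ interior B₂
  pp₂ : ∀ g ∈ G₂, g ∉ J → ⇑g '' B₂ ⊆ interior B₁
  lim₁ : limitSet G₁ \ limitSet J ⊆ interior B₂
  lim₂ : limitSet G₂ \ limitSet J ⊆ interior B₁

/-- `G₀` is in HNN ping-pong position with respect to `f`, `J₁`, `J₋₁`, witnessed by the
closed sets `B₁`, `Bm` (where `Bm` plays the role of `B₋₁`). -/
structure HNNPingPong (G₀ J₁ Jm : Subgroup (M ≃ₜ M)) (f : M ≃ₜ M) (B₁ Bm : Set M) :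
    Prop where
  isClosed₁ : IsClosed B₁
  isClosedm : IsClosed Bm
  int_nonempty₁ : (interior B₁).Nonempty
  int_nonemptym : (interior Bm).Nonempty
  int_disjoint : interior B₁ ∩ interior Bm = ∅
  inv₁ : ∀ j ∈ J₁, ⇑j '' B₁ = B₁
  invm : ∀ j ∈ Jm, ⇑j '' Bm = Bm
  prec₁ : ∀ g ∈ G₀, g ∉ J₁ → ⇑g '' B₁ ∩ B₁ = ∅
  precm : ∀ g ∈ G₀, g ∉ Jm → ⇑g '' Bm ∩ Bm = ∅
  cross : ∀ g ∈ G₀, ⇑g '' B₁ ∩ Bm = ∅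
  mapf : ⇑f '' ((B₁ ∪ Bm)ᶜ ∪ B₁) = interior B₁
  lim₁ : limitSet G₀ ∩ B₁ = limitSet J₁
  limm : limitSet G₀ ∩ Bm = limitSet Jm
  proper : (⋃ g ∈ G₀, ⇑g '' (B₁ ∪ Bm))ᶜ.Nonempty

/-- A letter of type `i` (`i = 0` for `G₁`, `i = 1` for `G₂`) for amalgamated free product
normal forms: an element of `G_{i+1} ∖ J`. -/
def AFPLetter (G₁ G₂ J : Subgroup (M ≃ₜ M)) (i : Fin 2) (g : M ≃ₜ M) : Prop :=
  g ∈ (if i = 0 then G₁ else G₂) ∧ g ∉ J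

/-- `h` is an `(i,j)`-form: a product of a nonempty alternating list of letters, whose first
letter lies in `G_i ∖ J` and whose last letter lies in `G_j ∖ J` (indices shifted so that
`0` stands for `G₁` and `1` for `G₂`). -/
def IsIJForm (G₁ G₂ J : Subgroup (M ≃ₜ M)) (i j : Fin 2) (h : M ≃ₜ M) : Prop :=
  ∃ l : List (M ≃ₜ M), l ≠ [] ∧ l.prod = h ∧
    (∀ g ∈ l, AFPLetter G₁ G₂ J 0 g ∨ AFPLetter G₁ G₂ J 1 g) ∧
    l.Chain' (fun a b => ∀ c : Fin 2, AFPLetter G₁ G₂ J c a → AFPLetter G₁ G₂ J (1 - c) b) ∧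
    (∀ hne : l ≠ [], AFPLetter G₁ G₂ J i (l.head hne)) ∧
    (∀ hne : l ≠ [], AFPLetter G₁ G₂ J j (l.getLast hne))

theorem mul_apply (g h : M ≃ₜ M) (x : M) : (g * h) x = g (h x) := rfl

theorem inv_apply_self (g : M ≃ₜ M) (x : M) : g⁻¹ (g x) = x := g.symm_apply_apply x

theorem apply_inv_self (g : M ≃ₜ M) (x : M) : g (g⁻¹ x) = x := g.apply_symm_apply x

theorem exists_ne_ne {X : Type*} {p : Fin 3 → X} (hp : Function.Injective p) (d e : X) :
    ∃ i, p i ≠ d ∧ p i ≠ e := by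
  by_contra! h
  have key : ∀ i j k : Fin 3, i ≠ j → i ≠ k → j ≠ k → p i = d → False := by
    intro i j k hij hik hjk hi
    have h1 := h j fun hj => hij (hp (hi.trans hj.symm))
    have h2 := h k fun hk => hik (hp (hi.trans hk.symm))
    exact hjk (hp (h1.trans h2.symm))
  by_cases h0 : p 0 = d
  · exact key 0 1 2 (by decide) (by decide) (by decide) h0
  by_cases h1 : p 1 = d
  · exact key 1 0 2 (by decide) (by decide) (by decide) h1
  exact absurd (hp ((h 0 h0).trans (h 1 h1).symm)) (by decide)

theorem exists_subseq_const_or_injective {α : Type*} (u : ℕ → α) :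
    ∃ φ : ℕ → ℕ, StrictMono φ ∧ ((∀ n, u (φ n) = u (φ 0)) ∨ Function.Injective (u ∘ φ)) := by
  obtain ⟨φ, hφ | hφ⟩ := exists_increasing_or_nonincreasing_subseq (· = ·) u
  · refine ⟨φ, φ.strictMono, Or.inl fun n => ?_⟩
    rcases Nat.eq_zero_or_pos n with rfl | hn
    · rfl
    · exact (hφ 0 n hn).symm
  · refine ⟨φ, φ.strictMono, Or.inr fun m n h => ?_⟩
    rcases lt_trichotomy m n with hl | hl | hl
    · exact (hφ m n hl h).elim
    · exact hl
    · exact (hφ n m hl h.symm).elim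

section ConvSeq

theorem IsConvSeq.comp {g : ℕ → M ≃ₜ M} {a r : M} (h : IsConvSeq g a r) {φ : ℕ → ℕ}
    (hφ : Tendsto φ atTop atTop) : IsConvSeq (g ∘ φ) a r :=
  fun K hK hr U hU => hφ.eventually (h K hK hr U hU)

theorem IsConvSeq.tendsto {g : ℕ → M ≃ₜ M} {a r : M} (h : IsConvSeq g a r) {w : M}
    (hw : w ≠ r) : Tendsto (fun k => g k w) atTop (𝓝 a) := fun U hU => by
  have := h {w} isCompact_singleton (by simpa using hw.symm) U hU
  simpa using this

theorem IsConvSeq.tendsto_of_tendsto [CompactSpace M] [T2Space M] {g : ℕ → M ≃ₜ M}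
    {a r : M} (h : IsConvSeq g a r) {u : ℕ → M} {v : M} (hu : Tendsto u atTop (𝓝 v))
    (hv : v ≠ r) : Tendsto (fun k => g k (u k)) atTop (𝓝 a) := fun U hU => by
  obtain ⟨K, hKv, hKc, hK⟩ := exists_mem_nhds_isClosed_subset (isOpen_ne.mem_nhds hv)
  show ∀ᶠ k in atTop, g k (u k) ∈ U
  filter_upwards [h K hKc.isCompact (fun hr => hK hr rfl) U hU,
    hu.eventually_mem hKv] with k h1 h2
  exact h1 _ h2

theorem IsConvSeq.inv [CompactSpace M] [T2Space M] {g : ℕ → M ≃ₜ M} {a r : M}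
    (h : IsConvSeq g a r) : IsConvSeq (fun k => (g k)⁻¹) r a := by
  intro K hK ha U hU
  obtain ⟨V, hVU, hV, hrV⟩ := mem_nhds_iff.1 hU
  filter_upwards [h Vᶜ hV.isClosed_compl.isCompact (fun h => h hrV) Kᶜ
    (hK.isClosed.isOpen_compl.mem_nhds ha)] with k hk x hx
  by_contra hxU
  exact hk _ (fun hxV => hxU (hVU hxV)) (by rwa [apply_inv_self])

theorem IsConvSeq.mul_left {g : ℕ → M ≃ₜ M} {a r : M} (h : IsConvSeq g a r) (s : M ≃ₜ M) :
    IsConvSeq (fun k => s * g k) (s a) r := fun K hK hr U hU =>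
  h K hK hr (s ⁻¹' U) (s.continuous.continuousAt hU)

theorem IsConvSeq.mul_right {g : ℕ → M ≃ₜ M} {a r : M} (h : IsConvSeq g a r) (s : M ≃ₜ M) :
    IsConvSeq (fun k => g k * s) a (s⁻¹ r) := fun K hK hr U hU => by
  have := h (s '' K) (hK.image s.continuous)
    (by rintro ⟨x, hx, rfl⟩; exact hr (by rwa [inv_apply_self])) U hU
  filter_upwards [this] with k hk x hx
  exact hk _ ⟨x, hx, rfl⟩

theorem IsConvSeq.attracting_unique [T2Space M] {p : Fin 3 → M} (hp : Function.Injective p)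
    {g : ℕ → M ≃ₜ M} {a r a' r' : M} (h : IsConvSeq g a r) (h' : IsConvSeq g a' r') :
    a = a' := by
  obtain ⟨i, h1, h2⟩ := exists_ne_ne hp r r'
  exact tendsto_nhds_unique (h.tendsto h1) (h'.tendsto h2)

theorem IsConvSeq.mem_limitSet {G : Subgroup (M ≃ₜ M)} {g : ℕ → M ≃ₜ M} {a r : M}
    (h : IsConvSeq g a r) (hg : ∀ k, g k ∈ G) (hinj : Function.Injective g) :
    a ∈ limitSet G := ⟨g, hg, hinj, r, h⟩

theorem limitSet_mono {G H : Subgroup (M ≃ₜ M)} (h : G ≤ H) : limitSet G ⊆ limitSet H :=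
  fun _ ⟨g, hg, hi, z, hc⟩ => ⟨g, fun k => h (hg k), hi, z, hc⟩

theorem apply_mem_limitSet {G : Subgroup (M ≃ₜ M)} {s : M ≃ₜ M} (hs : s ∈ G) {x : M}
    (hx : x ∈ limitSet G) : s x ∈ limitSet G := by
  obtain ⟨g, hg, hi, z, hc⟩ := hx
  exact ⟨_, fun k => G.mul_mem hs (hg k), fun m n h => hi (mul_left_cancel h), z,
    hc.mul_left s⟩

theorem IsDiscreteConvGroup.mono {G H : Subgroup (M ≃ₜ M)} (hG : IsDiscreteConvGroup G)
    (h : H ≤ G) : IsDiscreteConvGroup H := fun g hg hi => hG g (fun k => h (hg k)) hi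

theorem IsDiscreteConvGroup.finite_of_forall {G : Subgroup (M ≃ₜ M)}
    (hG : IsDiscreteConvGroup G) {P : (M ≃ₜ M) → Prop}
    (hP : ∀ (g : ℕ → M ≃ₜ M) (c d : M), IsConvSeq g c d → (∀ k, P (g k)) → False) :
    {g | g ∈ G ∧ P g}.Finite := by
  by_contra hinf
  have e := Set.Infinite.natEmbedding _ hinf
  obtain ⟨φ, -, c, d, hc⟩ := hG (fun n => (e n : M ≃ₜ M)) (fun n => (e n).2.1)
    (fun m n h => e.injective (Subtype.ext h))
  exact hP _ c d hc fun k => (e (φ k)).2.2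

theorem IsDiscreteConvGroup.exists_subseq {G : Subgroup (M ≃ₜ M)}
    (hG : IsDiscreteConvGroup G) (g : ℕ → M ≃ₜ M) (hg : ∀ k, g k ∈ G) :
    ∃ φ : ℕ → ℕ, StrictMono φ ∧ ((∃ s, ∀ k, g (φ k) = s) ∨
      Function.Injective (g ∘ φ) ∧ ∃ a r, IsConvSeq (g ∘ φ) a r) := by
  obtain ⟨ψ, hψ, h | hinj⟩ := exists_subseq_const_or_injective g
  · exact ⟨ψ, hψ, Or.inl ⟨_, h⟩⟩
  · obtain ⟨φ, hφ, a, r, h⟩ := hG _ (fun k => hg (ψ k)) hinj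
    exact ⟨ψ ∘ φ, hψ.comp hφ, Or.inr ⟨hinj.comp hφ.injective, a, r, h⟩⟩

end ConvSeq

section Maj

/-- At least two of the three points `g (p i)` lie in `S`. -/
def Maj (p : Fin 3 → M) (g : M ≃ₜ M) (S : Set M) : Prop :=
  ∃ i j, i ≠ j ∧ g (p i) ∈ S ∧ g (p j) ∈ S

theorem Maj.inter {p : Fin 3 → M} {g : M ≃ₜ M} {S T : Set M} (hS : Maj p g S)
    (hT : Maj p g T) : ∃ i, g (p i) ∈ S ∧ g (p i) ∈ T := by
  obtain ⟨i, j, hij, hi, hj⟩ := hS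
  obtain ⟨k, l, hkl, hk, hl⟩ := hT
  have : i = k ∨ i = l ∨ j = k ∨ j = l := by omega
  rcases this with rfl | rfl | rfl | rfl
  exacts [⟨_, hi, hk⟩, ⟨_, hi, hl⟩, ⟨_, hj, hk⟩, ⟨_, hj, hl⟩]

theorem Maj.imp {p : Fin 3 → M} {g h : M ≃ₜ M} {S T : Set M} (hS : Maj p g S)
    (hST : ∀ x, g x ∈ S → h x ∈ T) : Maj p h T := by
  obtain ⟨i, j, hij, hi, hj⟩ := hS
  exact ⟨i, j, hij, hST _ hi, hST _ hj⟩

theorem Maj.mono {p : Fin 3 → M} {g : M ≃ₜ M} {S T : Set M} (hS : Maj p g S)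
    (hST : S ⊆ T) : Maj p g T := hS.imp fun _ h => hST h

theorem IsConvSeq.eventually_maj {p : Fin 3 → M} (hp : Function.Injective p)
    {g : ℕ → M ≃ₜ M} {a r : M} (h : IsConvSeq g a r) {U : Set M} (hU : U ∈ 𝓝 a) :
    ∀ᶠ k in atTop, Maj p (g k) U := by
  obtain ⟨i, hi, -⟩ := exists_ne_ne hp r r
  obtain ⟨j, hj, hij⟩ := exists_ne_ne hp r (p i)
  filter_upwards [h.tendsto hi hU, h.tendsto hj hU] with k h1 h2
  exact ⟨i, j, fun h => hij (by rw [h]), h1, h2⟩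

end Maj

section Annuli

/-- A countable family of nested pairs of sets `inner i ⊆ outer i k`, shrinking to each point. -/
structure AnnuliFamily (M : Type*) [TopologicalSpace M] where
  /-- The closed inner sets. -/
  inner : ℕ → Set M
  /-- The open outer sets. -/
  outer : ℕ → ℕ → Set M
  isClosed_inner : ∀ i, IsClosed (inner i)
  isOpen_outer : ∀ i k, IsOpen (outer i k)
  inner_subset : ∀ i k, inner i ⊆ outer i k
  closure_outer_succ : ∀ i k, closure (outer i (k + 1)) ⊆ outer i k
  exists_mem_nhds : ∀ a, ∀ N ∈ 𝓝 a, ∃ i k, inner i ∈ 𝓝 a ∧ outer i k ⊆ N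

theorem nonempty_annuliFamily [CompactSpace M] [TopologicalSpace.MetrizableSpace M] :
    Nonempty (AnnuliFamily M) := by
  let _ := TopologicalSpace.metrizableSpaceMetric M
  obtain ⟨b, hbc, -, hb⟩ := TopologicalSpace.exists_countable_basis M
  obtain ⟨f, hf⟩ := (hbc.insert ∅).exists_eq_range (insert_nonempty _ _)
  refine ⟨⟨fun i => closure (f i), fun i k => Metric.thickening (1 / ((k : ℝ) + 1)) (closure (f i)),
    fun _ => isClosed_closure, fun _ _ => Metric.isOpen_thickening,
    fun _ _ => Metric.self_subset_thickening (by positivity) _, fun i k => ?_, fun a N hN => ?_⟩⟩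
  · refine (Metric.closure_thickening_subset_cthickening _ _).trans
      (Metric.cthickening_subset_thickening' (by positivity) ?_ _)
    exact one_div_lt_one_div_of_lt (by positivity) (by push_cast; linarith)
  · obtain ⟨K, hKa, hKc, hK⟩ := exists_mem_nhds_isClosed_subset (interior_mem_nhds.2 hN)
    obtain ⟨V, hVb, haV, hVK⟩ := hb.mem_nhds_iff.1 hKa
    obtain ⟨i, rfl⟩ : V ∈ range f := hf ▸ mem_insert_of_mem _ hVb
    have hcl : closure (f i) ⊆ interior N := (closure_minimal hVK hKc).trans hK
    obtain ⟨δ, hδ, hδN⟩ := isClosed_closure.isCompact.exists_thickening_subset_open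
      isOpen_interior hcl
    obtain ⟨k, hk⟩ := exists_nat_one_div_lt hδ
    exact ⟨i, k, mem_of_superset ((hb.isOpen hVb).mem_nhds haV) subset_closure,
      (Metric.thickening_mono hk.le _).trans (hδN.trans interior_subset)⟩

end Annuli

section Length

theorem exists_slow_length {Γ : Type*} [Group Γ] (G : Subgroup Γ) (T : ℕ → Set Γ)
    (hT : ∀ n, (T n).Finite) (hcov : ∀ g ∈ G, ∃ n, g ∈ T n) :
    ∃ L : Γ → ℕ, (∀ n, {g | g ∈ G ∧ L g ≤ n}.Finite) ∧ (∀ n, ∀ g ∈ T n, L g ≤ n) ∧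
      ∀ g ∈ G, ∀ h ∈ G, L (g * h⁻¹) ≤ L g + L h + 1 := by
  classical
  let F : ℕ → Set Γ := fun n =>
    Nat.rec (T 0) (fun n S => S ∪ T (n + 1) ∪ image2 (fun g h => g * h⁻¹) S S) n
  have hF : ∀ n, F (n + 1) = F n ∪ T (n + 1) ∪ image2 (fun g h => g * h⁻¹) (F n) (F n) :=
    fun n => rfl
  have hfin : ∀ n, (F n).Finite := by
    intro n
    induction n with
    | zero => exact hT 0
    | succ n ih => rw [hF]; exact (ih.union (hT _)).union (ih.image2 _ ih)
  have hmono : Monotone F := monotone_nat_of_le_succ fun n => by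
    rw [hF]; exact fun x hx => Or.inl (Or.inl hx)
  have hTF : ∀ n, T n ⊆ F n := by
    intro n
    cases n with
    | zero => exact subset_rfl
    | succ n => rw [hF]; exact fun x hx => Or.inl (Or.inr hx)
  have hle : ∀ {n g}, g ∈ F n → sInf {n | g ∈ F n} ≤ n := fun h => Nat.sInf_le h
  have hmem : ∀ g ∈ G, g ∈ F (sInf {n | g ∈ F n}) := fun g hg => by
    obtain ⟨n, hn⟩ := hcov g hg
    exact Nat.sInf_mem (s := {n | g ∈ F n}) ⟨n, hTF n hn⟩
  refine ⟨fun g => sInf {n | g ∈ F n}, fun n => (hfin n).subset ?_, fun n g hg => hle (hTF n hg),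
    fun g hg h hh => hle ?_⟩
  · rintro g ⟨hg, hn⟩
    exact hmono hn (hmem g hg)
  · rw [hF]
    exact Or.inr ⟨g, hmono (Nat.le_add_right _ _) (hmem g hg), h,
      hmono (Nat.le_add_left _ _) (hmem h hh), rfl⟩

end Length

section Finiteness

theorem IsConvSeq.attracting_mem_of_maj {p : Fin 3 → M} (hp : Function.Injective p)
    {g : ℕ → M ≃ₜ M} {c d : M} (h : IsConvSeq g c d) {S : Set M} (hS : IsClosed S)
    (hg : ∀ k, Maj p (g k) S) : c ∈ S := by
  by_contra hc
  obtain ⟨k, hk⟩ := (h.eventually_maj hp (hS.isOpen_compl.mem_nhds hc)).exists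
  obtain ⟨i, h1, h2⟩ := (hg k).inter hk
  exact h2 h1

namespace AnnuliFamily

/-- The element `β` separates the pair indexed by `l` when seen from `x`. -/
def Sees (A : AnnuliFamily M) (p : Fin 3 → M) (x β : M ≃ₜ M) (l : ℕ × ℕ) : Prop :=
  Maj p β (A.outer l.1 l.2)ᶜ ∧ Maj p (β * x) (A.inner l.1)

/-- The element `β` pulls the pair indexed by `l` back to a pair that is not nested inside the
pair indexed by `a`. -/
def Crosses (A : AnnuliFamily M) (p : Fin 3 → M) (a : ℕ × ℕ) (β : M ≃ₜ M) (l : ℕ × ℕ) : Prop :=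
  Maj p β (A.outer l.1 l.2)ᶜ ∧ (∃ u ∈ A.inner a.1, β u ∈ A.inner l.1) ∧
    ∃ y ∉ A.outer a.1 a.2, β y ∈ closure (A.outer l.1 (l.2 + 1))

variable {G : Subgroup (M ≃ₜ M)} (A : AnnuliFamily M) {p : Fin 3 → M}

theorem countable_of_isDiscreteConvGroup [T1Space M] (A : AnnuliFamily M)
    (hG : IsDiscreteConvGroup G) (hp : Function.Injective p) : (G : Set (M ≃ₜ M)).Countable := by
  have hsub : (G : Set (M ≃ₜ M)) ⊆ ⋃ v : Fin 3 → Fin 3 → ℕ × ℕ, {g | g ∈ G ∧ ∀ i j, i ≠ j →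
      g (p i) ∈ A.inner (v i j).1 ∧ g (p j) ∉ A.outer (v i j).1 (v i j).2} := by
    intro g hg
    have : ∀ i j, ∃ l : ℕ × ℕ, i ≠ j →
        g (p i) ∈ A.inner l.1 ∧ g (p j) ∉ A.outer l.1 l.2 := by
      intro i j
      by_cases hij : i = j
      · exact ⟨(0, 0), fun h => (h hij).elim⟩
      · obtain ⟨n, k, h1, h2⟩ := A.exists_mem_nhds (g (p i)) {g (p j)}ᶜ
          (isOpen_ne.mem_nhds fun h => hij (hp (g.injective h)))
        exact ⟨(n, k), fun _ => ⟨mem_of_mem_nhds h1, fun h => h2 h rfl⟩⟩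
    choose v hv using this
    exact mem_iUnion.2 ⟨v, hg, hv⟩
  refine (countable_iUnion fun v => Set.Finite.countable ?_).mono hsub
  refine hG.finite_of_forall fun g c d hc hg => ?_
  obtain ⟨i, hi, -⟩ := exists_ne_ne hp d d
  obtain ⟨j, hj, hij⟩ := exists_ne_ne hp d (p i)
  have hg' := fun k => hg k i j fun h => hij (by rw [h])
  have h1 := (A.isClosed_inner _).mem_of_tendsto (hc.tendsto hi)
    (Eventually.of_forall fun k => (hg' k).1)
  have h2 := (A.isOpen_outer _ _).isClosed_compl.mem_of_tendsto (hc.tendsto hj)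
    (Eventually.of_forall fun k => (hg' k).2)
  exact h2 (A.inner_subset _ _ h1)

theorem finite_sees (hG : IsDiscreteConvGroup G) (hp : Function.Injective p) (x : M ≃ₜ M)
    (l : ℕ × ℕ) : {β | β ∈ G ∧ A.Sees p x β l}.Finite := by
  refine hG.finite_of_forall fun g c d hc hg => ?_
  exact hc.attracting_mem_of_maj hp (A.isOpen_outer _ _).isClosed_compl (fun k => (hg k).1)
    (A.inner_subset _ _ ((hc.mul_right x).attracting_mem_of_maj hp (A.isClosed_inner _)
      fun k => (hg k).2))

theorem finite_crosses [CompactSpace M] (hG : IsDiscreteConvGroup G)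
    (hp : Function.Injective p) (a l : ℕ × ℕ) : {β | β ∈ G ∧ A.Crosses p a β l}.Finite := by
  refine hG.finite_of_forall fun g c d hc hg => ?_
  have hcO := hc.attracting_mem_of_maj hp (A.isOpen_outer _ _).isClosed_compl
    fun k => (hg k).1
  by_cases hd : d ∈ A.inner a.1
  · obtain ⟨k, hk⟩ := (hc (A.outer a.1 a.2)ᶜ (A.isOpen_outer _ _).isClosed_compl.isCompact
      (fun h => h (A.inner_subset _ _ hd)) _ (isClosed_closure.isOpen_compl.mem_nhds
        fun h => hcO (A.closure_outer_succ _ _ h))).exists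
    obtain ⟨-, -, y, hy, hyc⟩ := hg k
    exact hk y hy hyc
  · obtain ⟨k, hk⟩ := (hc _ (A.isClosed_inner a.1).isCompact hd _
      ((A.isClosed_inner l.1).isOpen_compl.mem_nhds
        fun h => hcO (A.inner_subset _ _ h))).exists
    obtain ⟨-, ⟨u, hu, huc⟩, -⟩ := hg k
    exact hk u hu huc

theorem exists_length [CompactSpace M] [T2Space M] (hG : IsDiscreteConvGroup G)
    (hp : Function.Injective p) :
    ∃ L s : (M ≃ₜ M) → ℕ, (∀ n, {g | g ∈ G ∧ L g ≤ n}.Finite) ∧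
      (∀ g ∈ G, ∀ h ∈ G, L (g * h⁻¹) ≤ L g + L h + 1) ∧
      (∀ x ∈ G, ∀ β ∈ G, ∀ l : ℕ × ℕ, A.Sees p x β l → L β ≤ max (l.1 + l.2) (s x)) ∧
      ∀ a l : ℕ × ℕ, ∀ β ∈ G, A.Crosses p a β l → L β ≤ max (l.1 + l.2) (a.1 + a.2) := by
  obtain ⟨e, he⟩ := (A.countable_of_isDiscreteConvGroup hG hp).exists_eq_range ⟨1, G.one_mem⟩
  have he' : ∀ x ∈ G, ∃ n, e n = x := fun x hx => by
    have : x ∈ (G : Set (M ≃ₜ M)) := hx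
    rwa [he] at this
  choose! s hs using he'
  let P : ℕ → Set (ℕ × ℕ) := fun n => {l | l.1 + l.2 ≤ n}
  have hP : ∀ n, (P n).Finite := fun n => (finite_Iic (n, n)).subset fun l (hl : _ ≤ n) =>
    ⟨(Nat.le_add_right _ _).trans hl, (Nat.le_add_left _ _).trans hl⟩
  obtain ⟨L, hL1, hL2, hL3⟩ := exists_slow_length G
    (fun n => e '' Iic n ∪ (⋃ l ∈ P n, ⋃ m ∈ Iic n, {β | β ∈ G ∧ A.Sees p (e m) β l}) ∪
      ⋃ l ∈ P n, ⋃ a ∈ P n, {β | β ∈ G ∧ A.Crosses p a β l})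
    (fun n => (((finite_Iic n).image e).union ((hP n).biUnion fun l _ =>
        (finite_Iic n).biUnion fun m _ => A.finite_sees hG hp _ l)).union
      ((hP n).biUnion fun l _ => (hP n).biUnion fun a _ => A.finite_crosses hG hp a l))
    (fun g hg => ⟨s g, Or.inl (Or.inl ⟨s g, mem_Iic.2 le_rfl, hs g hg⟩)⟩)
  refine ⟨L, s, hL1, hL3, fun x hx β hβ l h => hL2 _ _ (Or.inl (Or.inr ?_)),
    fun a l β hβ h => hL2 _ _ (Or.inr ?_)⟩
  · exact mem_biUnion (show l ∈ P _ from le_max_left (l.1 + l.2) (s x))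
      (mem_biUnion (mem_Iic.2 (le_max_right _ _)) ⟨hβ, by rwa [hs x hx]⟩)
  · exact mem_biUnion (show l ∈ P _ from le_max_left (l.1 + l.2) (a.1 + a.2))
      (mem_biUnion (show a ∈ P _ from le_max_right (l.1 + l.2) (a.1 + a.2)) ⟨hβ, h⟩)

end AnnuliFamily

end Finiteness

section Potential

namespace AnnuliFamily

/-- The pair carried by `q` is strictly nested around the pair carried by `q'`. -/
def Nested (A : AnnuliFamily M) (q q' : (M ≃ₜ M) × (ℕ × ℕ)) : Prop :=
  (∀ z, q'.1 z ∈ A.outer q'.2.1 q'.2.2 → q.1 z ∈ A.inner q.2.1) ∧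
    ∃ w, q.1 w ∈ A.inner q.2.1 ∧ q'.1 w ∉ A.inner q'.2.1

/-- A strictly nested list of pairs, indexed by elements of `G`, all of which separate `x` from
the identity. -/
def IsNest (A : AnnuliFamily M) (p : Fin 3 → M) (G : Subgroup (M ≃ₜ M)) (x : M ≃ₜ M)
    (l : List ((M ≃ₜ M) × (ℕ × ℕ))) : Prop :=
  (∀ q ∈ l, q.1 ∈ G ∧ A.Sees p x q.1 q.2) ∧ l.Pairwise A.Nested

theorem IsNest.nodup {A : AnnuliFamily M} {p : Fin 3 → M} {G : Subgroup (M ≃ₜ M)} {x : M ≃ₜ M}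
    {l : List ((M ≃ₜ M) × (ℕ × ℕ))} (h : A.IsNest p G x l) : l.Nodup :=
  h.2.imp fun hab => by
    rintro rfl
    obtain ⟨-, w, h1, h2⟩ := hab
    exact h2 h1

end AnnuliFamily

/-- The weight of a list of indexed elements, starting from `u`. -/
def pathWeight {Γ : Type*} [Group Γ] (L : Γ → ℕ) : Γ → List (Γ × (ℕ × ℕ)) → ℤ
  | _, [] => 0
  | u, q :: t => (L (q.1 * u⁻¹) : ℤ) - (2 * (q.2.1 + q.2.2 : ℕ) + 1) + pathWeight L q.1 t

theorem pathWeight_map_mul_right {Γ : Type*} [Group Γ] (L : Γ → ℕ) (c : Γ)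
    (l : List (Γ × (ℕ × ℕ))) (u : Γ) :
    pathWeight L (u * c) (l.map fun q => (q.1 * c, q.2)) = pathWeight L u l := by
  induction l generalizing u with
  | nil => rfl
  | cons q t ih => simp [pathWeight, ih, mul_assoc]

theorem pathWeight_append_le {Γ : Type*} [Group Γ] {G : Subgroup Γ} {L : Γ → ℕ}
    (hL : ∀ g ∈ G, ∀ h ∈ G, L (g * h⁻¹) ≤ L g + L h + 1) (pre suf : List (Γ × (ℕ × ℕ)))
    (hl : ∀ q ∈ pre ++ suf, q.1 ∈ G) {u : Γ} (hu : u ∈ G) :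
    pathWeight L u (pre ++ suf) ≤ L u + 1 +
      (pre.map fun q => 2 * (L q.1 : ℤ) - 2 * (q.2.1 + q.2.2 : ℕ)).sum + pathWeight L 1 suf := by
  induction pre generalizing u with
  | nil =>
    cases suf with
    | nil => simp [pathWeight]; positivity
    | cons q t =>
      have := hL q.1 (hl q (by simp)) u hu
      simp only [pathWeight, List.nil_append, List.map_nil, List.sum_nil, inv_one, mul_one]
      omega
  | cons q t ih =>
    have h1 := hL q.1 (hl q (by simp)) u hu
    have h2 := ih (fun r hr => hl r (by simp at hr ⊢; tauto)) (hl q (by simp))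
    simp only [List.cons_append, pathWeight, List.map_cons, List.sum_cons]
    omega

theorem List.sum_map_le_card_mul {α : Type*} {φ : α → ℤ} {B : ℤ} (hB : 0 ≤ B) (l : List α)
    (hl : l.Nodup) (S : Finset α) (hS : ∀ q ∈ l, q ∈ S → φ q ≤ B)
    (hS' : ∀ q ∈ l, q ∉ S → φ q ≤ 0) : (l.map φ).sum ≤ S.card * B := by
  classical
  induction l generalizing S with
  | nil => simp; positivity
  | cons q t ih =>
    rw [List.nodup_cons] at hl
    simp only [List.map_cons, List.sum_cons]
    by_cases hq : q ∈ S
    · have h1 := ih hl.2 (S.erase q) (fun r hr hrS => hS r (by simp [hr]) (Finset.mem_of_mem_erase hrS))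
        (fun r hr hrS => hS' r (by simp [hr]) fun h => hrS (Finset.mem_erase.2
          ⟨fun h => hl.1 (h ▸ hr), h⟩))
      have h2 := hS q (by simp) hq
      have h3 : (S.card : ℤ) = (S.erase q).card + 1 := by
        exact_mod_cast (Finset.card_erase_add_one hq).symm
      rw [h3]
      linarith
    · have h1 := ih hl.2 S (fun r hr => hS r (by simp [hr])) (fun r hr => hS' r (by simp [hr]))
      have h2 := hS' q (by simp) hq
      linarith

theorem exists_sum_le {Γ : Type*} [Group Γ] {G : Subgroup Γ} {L : Γ → ℕ}
    (hL : ∀ n, {g | g ∈ G ∧ L g ≤ n}.Finite) (s : ℕ) :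
    ∃ K : ℤ, ∀ l : List (Γ × (ℕ × ℕ)), l.Nodup →
      (∀ q ∈ l, q.1 ∈ G ∧ L q.1 ≤ max (q.2.1 + q.2.2) s) →
      (l.map fun q => 2 * (L q.1 : ℤ) - 2 * (q.2.1 + q.2.2 : ℕ)).sum ≤ K := by
  have hfin := (hL s).prod (finite_Iic (s, s))
  refine ⟨hfin.toFinset.card * (2 * s), fun l hl hq => ?_⟩
  refine List.sum_map_le_card_mul (by positivity) l hl _ (fun q hql h => ?_) fun q hql h => ?_
  · have h1 := ((hfin.mem_toFinset).1 h).1.2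
    omega
  · obtain ⟨h1, h2⟩ := hq q hql
    by_contra! hlt
    refine h ((hfin.mem_toFinset).2 ⟨⟨h1, show L q.1 ≤ s by omega⟩,
      show q.2.1 ≤ s by omega, show q.2.2 ≤ s by omega⟩)

theorem List.exists_eq_append_forall {α : Type*} (P : α → Prop) (l : List α) :
    ∃ pre suf, l = pre ++ suf ∧ (∀ q ∈ pre, P q) ∧
      (suf = [] ∨ ∃ q t, suf = q :: t ∧ ¬ P q) := by
  induction l with
  | nil => exact ⟨[], [], rfl, by simp, Or.inl rfl⟩
  | cons q t ih =>
    by_cases hq : P q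
    · obtain ⟨pre, suf, h1, h2, h3⟩ := ih
      exact ⟨q :: pre, suf, by simp [h1], by simpa using ⟨hq, h2⟩, h3⟩
    · exact ⟨[], q :: t, rfl, by simp, Or.inr ⟨q, t, rfl, hq⟩⟩

end Potential

section Descent

namespace AnnuliFamily

variable {G : Subgroup (M ≃ₜ M)} {p : Fin 3 → M}

theorem exists_isNest_max (A : AnnuliFamily M) {L s : (M ≃ₜ M) → ℕ}
    (hL : ∀ n, {g | g ∈ G ∧ L g ≤ n}.Finite)
    (hL' : ∀ g ∈ G, ∀ h ∈ G, L (g * h⁻¹) ≤ L g + L h + 1)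
    (hs : ∀ x ∈ G, ∀ β ∈ G, ∀ l : ℕ × ℕ, A.Sees p x β l → L β ≤ max (l.1 + l.2) (s x)) :
    ∃ f : (M ≃ₜ M) → ℕ, ∀ x ∈ G, (∃ l, A.IsNest p G x l ∧ (f x : ℤ) ≤ pathWeight L 1 l) ∧
      ∀ l, A.IsNest p G x l → pathWeight L 1 l ≤ f x := by
  refine ⟨fun x => sSup {n : ℕ | ∃ l, A.IsNest p G x l ∧ (n : ℤ) ≤ pathWeight L 1 l},
    fun x hx => ?_⟩
  have hne : {n : ℕ | ∃ l, A.IsNest p G x l ∧ (n : ℤ) ≤ pathWeight L 1 l}.Nonempty :=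
    ⟨0, [], ⟨by simp, List.Pairwise.nil⟩, by simp [pathWeight]⟩
  have hbdd : BddAbove {n : ℕ | ∃ l, A.IsNest p G x l ∧ (n : ℤ) ≤ pathWeight L 1 l} := by
    obtain ⟨K, hK⟩ := exists_sum_le hL (s x)
    refine ⟨(L 1 + 1 + K).toNat, ?_⟩
    rintro n ⟨l, hl, hn⟩
    have h1 := pathWeight_append_le hL' l [] (by simpa using fun a b c h => (hl.1 _ h).1)
      G.one_mem
    have h2 := hK l hl.nodup fun q hq => ⟨(hl.1 q hq).1, hs x hx _ (hl.1 q hq).1 _ (hl.1 q hq).2⟩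
    rw [List.append_nil] at h1
    simp only [pathWeight] at h1
    omega
  refine ⟨Nat.sSup_mem hne hbdd, fun l hl => ?_⟩
  by_contra! hlt
  have : (pathWeight L 1 l).toNat ≤
      sSup {n : ℕ | ∃ l, A.IsNest p G x l ∧ (n : ℤ) ≤ pathWeight L 1 l} :=
    le_csSup hbdd ⟨l, hl, by omega⟩
  omega

theorem IsNest.cons_map {A : AnnuliFamily M} {σ x : M ≃ₜ M} (hσ : σ ∈ G) {a a' : ℕ × ℕ}
    (ha : A.outer a.1 a.2 ⊆ A.inner a'.1) (hw : (A.inner a'.1 \ A.outer a.1 a.2).Nonempty)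
    (hσa : Maj p σ (A.outer a'.1 a'.2)ᶜ) (hxa : Maj p x (A.inner a'.1))
    {l : List ((M ≃ₜ M) × (ℕ × ℕ))} (hl : A.IsNest p G x l)
    (hla : ∀ q ∈ l, ∀ z, q.1 z ∈ A.outer q.2.1 q.2.2 → z ∈ A.outer a.1 a.2) :
    A.IsNest p G (σ⁻¹ * x) ((σ, a') :: l.map fun q => (q.1 * σ, q.2)) := by
  refine ⟨?_, ?_⟩
  · intro q hq
    rcases List.mem_cons.1 hq with rfl | hq
    · exact ⟨hσ, hσa, by rwa [mul_inv_cancel_left]⟩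
    · obtain ⟨q, hql, rfl⟩ := List.mem_map.1 hq
      obtain ⟨h1, h2, h3⟩ := hl.1 q hql
      refine ⟨G.mul_mem h1 hσ, hσa.imp fun z hz hz' => ?_, ?_⟩
      · exact hz (A.inner_subset _ _ (ha (hla q hql _ hz')))
      · simpa [mul_assoc] using h3
  · refine List.pairwise_cons.2 ⟨?_, List.pairwise_map.2 (hl.2.imp ?_)⟩
    · intro q hq
      obtain ⟨q, hql, rfl⟩ := List.mem_map.1 hq
      obtain ⟨w, hw1, hw2⟩ := hw
      refine ⟨fun z hz => ha (hla q hql _ hz), σ⁻¹ w, ?_, fun h => hw2 ?_⟩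
      · show σ (σ⁻¹ w) ∈ _
        rwa [apply_inv_self]
      · change q.1 (σ (σ⁻¹ w)) ∈ _ at h
        rw [apply_inv_self] at h
        exact hla q hql _ (A.inner_subset _ _ h)
    · rintro q q' ⟨h1, w, h2, h3⟩
      refine ⟨fun z hz => h1 _ hz, σ⁻¹ w, ?_, ?_⟩
      · show q.1 (σ (σ⁻¹ w)) ∈ _
        rwa [apply_inv_self]
      · show q'.1 (σ (σ⁻¹ w)) ∉ _
        rwa [apply_inv_self]

/-- After dropping the part of a nest that is not compatible with `a`, and shrinking the first
remaining outer set, every remaining pair lies inside the outer set of `a`. -/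
theorem IsNest.exists_split {A : AnnuliFamily M} {x : M ≃ₜ M} {a : ℕ × ℕ}
    {l : List ((M ≃ₜ M) × (ℕ × ℕ))} (hl : A.IsNest p G x l) (hxa : Maj p x (A.inner a.1))
    (L : (M ≃ₜ M) → ℕ) :
    ∃ pre suf suf', l = pre ++ suf ∧ (∀ q ∈ pre, A.Crosses p a q.1 q.2) ∧
      A.IsNest p G x suf' ∧
      (∀ q ∈ suf', ∀ z, q.1 z ∈ A.outer q.2.1 q.2.2 → z ∈ A.outer a.1 a.2) ∧
      pathWeight L 1 suf - 2 ≤ pathWeight L 1 suf' := by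
  obtain ⟨pre, suf, rfl, hpre, hsuf⟩ :=
    List.exists_eq_append_forall (fun q => A.Crosses p a q.1 q.2) l
  rcases hsuf with rfl | ⟨q, t, rfl, hq⟩
  · exact ⟨pre, [], [], rfl, hpre, ⟨by simp, List.Pairwise.nil⟩, by simp, by simp⟩
  · have hqt : A.IsNest p G x (q :: t) :=
      ⟨fun r hr => hl.1 r (by simp at hr ⊢; tauto), (List.pairwise_append.1 hl.2).2.1⟩
    obtain ⟨hqG, hqO, hqC⟩ := hqt.1 q (by simp)
    have hqa : ∀ z, q.1 z ∈ A.outer q.2.1 (q.2.2 + 1) → z ∈ A.outer a.1 a.2 := by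
      intro z hz
      by_contra hza
      obtain ⟨i, hi1, hi2⟩ :=
        Maj.inter (g := x) (S := q.1 ⁻¹' A.inner q.2.1) hqC hxa
      exact hq ⟨hqO, ⟨_, hi2, hi1⟩, z, hza, subset_closure hz⟩
    have hout : A.outer q.2.1 (q.2.2 + 1) ⊆ A.outer q.2.1 q.2.2 :=
      subset_closure.trans (A.closure_outer_succ _ _)
    obtain ⟨h1, h2⟩ := List.pairwise_cons.1 hqt.2
    refine ⟨pre, q :: t, (q.1, (q.2.1, q.2.2 + 1)) :: t, rfl, hpre, ⟨?_, ?_⟩, ?_, ?_⟩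
    · intro r hr
      rcases List.mem_cons.1 hr with rfl | hr
      · exact ⟨hqG, hqO.mono (compl_subset_compl.2 hout), hqC⟩
      · exact hqt.1 r (by simp [hr])
    · exact List.pairwise_cons.2 ⟨fun r hr => h1 r hr, h2⟩
    · intro r hr z hz
      rcases List.mem_cons.1 hr with rfl | hr
      · exact hqa z hz
      · exact hqa z (A.inner_subset _ _ ((h1 r hr).1 z hz))
    · simp only [pathWeight]
      push_cast
      linarith

end AnnuliFamily

/-- `f` increases strictly when a far away element is used to undo a nearby concentration
point. -/
def IsPotential (G : Subgroup (M ≃ₜ M)) (p : Fin 3 → M) (f : (M ≃ₜ M) → ℕ) : Prop :=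
  ∀ a b : M, a ≠ b → ∃ N ∈ 𝓝 a, ∃ N' ∈ 𝓝 b, ∃ R : Set (M ≃ₜ M),
    R.Finite ∧ ∀ σ ∈ G, ∀ x ∈ G, σ ∉ R → Maj p σ N' → Maj p x N → f x < f (σ⁻¹ * x)

theorem IsDiscreteConvGroup.exists_potential [CompactSpace M]
    [TopologicalSpace.MetrizableSpace M] {G : Subgroup (M ≃ₜ M)} (hG : IsDiscreteConvGroup G)
    {p : Fin 3 → M} (hp : Function.Injective p) :
    ∃ f : (M ≃ₜ M) → ℕ, IsPotential G p f := by
  obtain ⟨A⟩ := nonempty_annuliFamily (M := M)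
  obtain ⟨L, s, hL, hL', hs, hcr⟩ := A.exists_length hG hp
  obtain ⟨f, hf⟩ := A.exists_isNest_max hL hL' hs
  refine ⟨f, fun a b hab => ?_⟩
  by_cases hiso : ({a} : Set M) ∈ 𝓝 a
  · refine ⟨{a}, hiso, univ, univ_mem, ∅, finite_empty, fun σ _ x _ _ _ h => ?_⟩
    obtain ⟨i, j, hij, hi, hj⟩ := h
    exact (hij (hp (x.injective (hi.trans hj.symm)))).elim
  obtain ⟨N₁, N', hN₁o, hN'o, haN, hbN, hdisj⟩ := t2_separation hab
  obtain ⟨i', k', ha', hN₁⟩ := A.exists_mem_nhds a N₁ (hN₁o.mem_nhds haN)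
  obtain ⟨w, hw, hwa⟩ : ∃ w ∈ A.inner i', w ≠ a := by
    by_contra! h
    exact hiso (mem_of_superset ha' fun w hw => h w hw)
  obtain ⟨i, k, ha, hNa⟩ := A.exists_mem_nhds a (A.inner i' ∩ {w}ᶜ)
    (inter_mem ha' (isOpen_ne.mem_nhds hwa.symm))
  obtain ⟨K, hK⟩ := exists_sum_le hL (i + k)
  refine ⟨A.inner i, ha, N', hN'o.mem_nhds hbN, _,
    hL (2 * (i' + k' : ℕ) + L 1 + 4 + K).toNat, fun σ hσ x hx hσR hσN hxN => ?_⟩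
  have hxN' : Maj p x (A.inner i') := hxN.mono fun z hz => (hNa (A.inner_subset i k hz)).1
  obtain ⟨l, hl, hfl⟩ := (hf x hx).1
  obtain ⟨pre, suf, suf', rfl, hpre, hnest, hsuf, hwt⟩ := hl.exists_split (a := (i, k)) hxN L
  have hnew := (hf (σ⁻¹ * x) (G.mul_mem (G.inv_mem hσ) hx)).2 _
    (hnest.cons_map (a' := (i', k')) hσ (fun z hz => (hNa hz).1) ⟨w, hw, fun h => (hNa h).2 rfl⟩
      (hσN.mono fun z hz hz' => disjoint_left.1 hdisj (hN₁ hz') hz) hxN' hsuf)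
  have h1 := pathWeight_map_mul_right L σ suf' 1
  rw [one_mul] at h1
  have h2 := pathWeight_append_le hL' pre suf (fun q hq => (hl.1 q hq).1) G.one_mem
  have h3 := hK pre (List.nodup_append.1 hl.nodup).1 fun q hq =>
    ⟨(hl.1 q (by simp [hq])).1, hcr (i, k) q.2 _ (hl.1 q (by simp [hq])).1 (hpre q hq)⟩
  have h4 : ¬ L σ ≤ (2 * (i' + k' : ℕ) + L 1 + 4 + K).toNat := fun h => hσR ⟨hσ, h⟩
  simp only [pathWeight, h1, inv_one, mul_one] at hnew
  push_cast at h4 hnew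
  omega

end Descent

section Parabolic

theorem isEllipticElem_of_isOfFinOrder [T2Space M] {t : M ≃ₜ M} (ht : IsOfFinOrder t) :
    IsEllipticElem t := by
  have hfin : (Set.range fun n : ℤ => toCM (t ^ n)).Finite := by
    have := (finite_zpowers.2 ht).image toCM
    refine this.subset ?_
    rintro _ ⟨n, rfl⟩
    exact ⟨t ^ n, ⟨n, rfl⟩, rfl⟩
  unfold IsEllipticElem
  rw [hfin.isClosed.closure_eq]
  refine ⟨hfin.isCompact, ?_⟩
  rintro _ ⟨n, rfl⟩
  exact ⟨_, rfl⟩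

variable {G : Subgroup (M ≃ₜ M)} {p : Fin 3 → M}

theorem IsConvSeq.pow_fixed [T2Space M] (hp : Function.Injective p) {t : M ≃ₜ M} {φ : ℕ → ℕ}
    {c d : M} (h : IsConvSeq (fun k => t ^ φ k) c d) : t c = c := by
  have h1 := h.mul_left t
  have h2 := h.mul_right t
  simp only [(Commute.self_pow t _).eq] at h1
  exact h1.attracting_unique hp h2

theorem exists_isConvSeq_pow [CompactSpace M] [T2Space M] (hG : IsDiscreteConvGroup G)
    (hp : Function.Injective p) {t : M ≃ₜ M} (htG : t ∈ G) (ht : ¬ IsEllipticElem t) {q : M}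
    (hq : ∀ x, t x = x → x = q) :
    ∃ φ : ℕ → ℕ, IsConvSeq (fun k => t ^ φ k) q q := by
  obtain ⟨φ, -, c, d, h⟩ := hG (fun n => t ^ n) (fun n => G.pow_mem htG n)
    (injective_pow_iff_not_isOfFinOrder.2 fun h => ht (isEllipticElem_of_isOfFinOrder h))
  have hc := hq c (IsConvSeq.pow_fixed hp (φ := φ) h)
  have hd' : IsConvSeq (fun k => t⁻¹ ^ φ k) d c := by simpa using h.inv
  have hd'' := hd'.pow_fixed hp
  have hd := hq d (by rw [← hd'', apply_inv_self, hd''])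
  subst hc hd
  exact ⟨φ, h⟩

theorem exists_pow_apply_mem [CompactSpace M] [T2Space M] (hG : IsDiscreteConvGroup G)
    (hp : Function.Injective p) {t : M ≃ₜ M} (htG : t ∈ G) (ht : ¬ IsEllipticElem t) {q : M}
    (hq : ∀ x, t x = x → x = q) (x : M) {V : Set M} (hV : V ∈ 𝓝 q) :
    (∃ m : ℕ, (t ^ m) x ∈ V) ∧ ∃ m : ℕ, (t⁻¹ ^ m) x ∈ V := by
  by_cases hx : x = q
  · subst hx
    exact ⟨⟨0, mem_of_mem_nhds hV⟩, ⟨0, mem_of_mem_nhds hV⟩⟩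
  · obtain ⟨φ, h⟩ := exists_isConvSeq_pow hG hp htG ht hq
    have h' : IsConvSeq (fun k => t⁻¹ ^ φ k) q q := by simpa using h.inv
    obtain ⟨k, hk⟩ := ((h.tendsto hx).eventually_mem hV).exists
    obtain ⟨k', hk'⟩ := ((h'.tendsto hx).eventually_mem hV).exists
    exact ⟨⟨_, hk⟩, ⟨_, hk'⟩⟩

theorem conj_pow_apply (g t : M ≃ₜ M) (m : ℕ) (x : M) :
    ((g * t * g⁻¹) ^ m) (g x) = g ((t ^ m) x) := by
  rw [conj_pow, mul_apply, mul_apply, inv_apply_self]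

theorem IsConvSeq.false_of_conj [CompactSpace M] [T2Space M] (hp : Function.Injective p)
    {g : ℕ → M ≃ₜ M} {t : M ≃ₜ M} {a b q : M} (hg : IsConvSeq g b q)
    (hgq : Tendsto (fun k => g k q) atTop (𝓝 a)) (hab : a ≠ b)
    (ht : ∀ x, ∀ V ∈ 𝓝 q, ∃ m : ℕ, (t ^ m) x ∈ V)
    (h : IsConvSeq (fun k => g k * t * (g k)⁻¹) b a) : False := by
  obtain ⟨B, hBb, hBc, hB⟩ := exists_mem_nhds_isClosed_subset (isOpen_ne.mem_nhds hab.symm)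
  have haB : a ∉ B := fun h => hB h rfl
  obtain ⟨i, hi, -⟩ := exists_ne_ne hp q q
  obtain ⟨k, h1, h2, h3⟩ := ((h B hBc.isCompact haB B hBb).and
    ((hgq.eventually_mem (hBc.isOpen_compl.mem_nhds haB)).and
      ((hg.tendsto hi).eventually_mem hBb))).exists
  have key : ∀ m : ℕ, ((g k * t * (g k)⁻¹) ^ m) (g k (p i)) ∈ B := by
    intro m
    induction m with
    | zero => exact h3
    | succ m ih => rw [pow_succ']; exact h1 _ ih
  obtain ⟨m, hm⟩ := ht (p i) (g k ⁻¹' Bᶜ)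
    ((hBc.isOpen_compl.preimage (g k).continuous).mem_nhds h2)
  have := key m
  rw [conj_pow_apply] at this
  exact hm this

theorem IsConvSeq.false_of_parabolic [CompactSpace M] [T2Space M] (hG : IsDiscreteConvGroup G)
    (hp : Function.Injective p) {t : M ≃ₜ M} (htG : t ∈ G) (ht : IsParabolicElem t) {q : M}
    (htq : t q = q) {g : ℕ → M ≃ₜ M} (hgG : ∀ k, g k ∈ G) {a b : M} (hg : IsConvSeq g b q)
    (hgq : Tendsto (fun k => g k q) atTop (𝓝 a)) (hab : a ≠ b) : False := by
  obtain ⟨htell, htu⟩ := ht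
  have hfix : ∀ x, t x = x → x = q := fun x hx => htu.unique hx htq
  have hpow := exists_pow_apply_mem hG hp htG htell hfix
  obtain ⟨φ, hφ, hs | ⟨-, c, d, hcd⟩⟩ := hG.exists_subseq (fun k => g k * t * (g k)⁻¹)
    fun k => G.mul_mem (G.mul_mem (hgG k) htG) (G.inv_mem (hgG k))
  all_goals
    have hg' := hg.comp hφ.tendsto_atTop
    have hgq' := hgq.comp hφ.tendsto_atTop
    obtain ⟨i, hi, hti⟩ := exists_ne_ne hp q (t⁻¹ q)
    have hti' : t (p i) ≠ q := fun h => hti (by rw [← h, inv_apply_self])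
    have hb := hg'.tendsto hi
    have hb' := hg'.tendsto hti'
    have hconj : ∀ k x, (g (φ k) * t * (g (φ k))⁻¹) (g (φ k) x) = g (φ k) (t x) :=
      fun k x => by rw [mul_apply, mul_apply, inv_apply_self]
  · obtain ⟨s, hs⟩ := hs
    simp only [hs] at hconj
    have hsa : s a = a := by
      refine tendsto_nhds_unique ((s.continuous.tendsto a).comp hgq') ?_
      refine hgq'.congr fun k => ?_
      simp only [Function.comp_apply]
      rw [hconj, htq]
    have hsb : s b = b := by
      refine tendsto_nhds_unique ((s.continuous.tendsto b).comp hb) ?_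
      refine hb'.congr fun k => ?_
      simp only [Function.comp_apply]
      rw [hconj]
    have huniq : ∀ y, s y = y → y = g (φ 0) q := fun y hy => by
      have h0 := hconj 0 ((g (φ 0))⁻¹ y)
      rw [apply_inv_self, hy] at h0
      have h1 := hfix ((g (φ 0))⁻¹ y) (by
        rw [← inv_apply_self (g (φ 0)) (t _), ← h0])
      rw [← h1, apply_inv_self]
    exact hab ((huniq a hsa).trans (huniq b hsb).symm)
  · have hca : a ≠ d → c = a := fun had => tendsto_nhds_unique
      (hcd.tendsto_of_tendsto hgq' had) (hgq'.congr fun k => by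
        simp only [Function.comp_apply]
        rw [hconj, htq])
    have hcb : b ≠ d → c = b := fun hbd => tendsto_nhds_unique
      (hcd.tendsto_of_tendsto hb hbd) (hb'.congr fun k => by
        simp only [Function.comp_apply]
        rw [hconj])
    by_cases had : a = d
    · subst had
      obtain rfl := hcb hab.symm
      exact hg'.false_of_conj hp hgq' hab (fun x V hV => (hpow x hV).1) hcd
    · obtain rfl := hca had
      have hbd : b = d := by
        by_contra hbd
        exact hab (hcb hbd)
      subst hbd
      refine hg'.false_of_conj hp hgq' hab (fun x V hV => (hpow x hV).2) ?_
      simpa [mul_assoc, Function.comp_def] using hcd.inv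

theorem IsConicalLimitPt.exists_isConvSeq [CompactSpace M] [TopologicalSpace.MetrizableSpace M]
    (hG : IsDiscreteConvGroup G) (hp : Function.Injective p) {x : M}
    (hx : IsConicalLimitPt G x) :
    ∃ g : ℕ → M ≃ₜ M, (∀ k, g k ∈ G) ∧ Function.Injective g ∧ ∃ a b, a ≠ b ∧
      IsConvSeq g b x ∧ Tendsto (fun k => g k x) atTop (𝓝 a) := by
  obtain ⟨g, hgG, hinj, hK⟩ := hx
  obtain ⟨φ, hφ, b, d, hbd⟩ := hG g hgG hinj
  obtain ⟨a, ψ, hψ, ha⟩ := CompactSpace.tendsto_subseq fun k => g (φ k) x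
  have hbd' := hbd.comp hψ.tendsto_atTop
  have hne : a ≠ b := by
    obtain ⟨i, hi, hid⟩ := exists_ne_ne hp x d
    obtain ⟨K, hKc, hKΔ, hgK⟩ := hK _ hi
    have := hKc.isClosed.mem_of_tendsto (ha.prodMk_nhds (hbd'.tendsto hid))
      (Eventually.of_forall fun k => hgK _)
    exact hKΔ _ this
  have hdx : d = x := by
    by_contra hdx
    exact hne (tendsto_nhds_unique ha (hbd'.tendsto (Ne.symm hdx)))
  subst hdx
  exact ⟨_, fun k => hgG _, hinj.comp (hφ.comp hψ).injective, a, b, hne, hbd', ha⟩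

theorem IsParabolicPt.not_isConicalLimitPt [CompactSpace M]
    [TopologicalSpace.MetrizableSpace M] (hG : IsDiscreteConvGroup G)
    (hp : Function.Injective p) {x : M} (hx : IsParabolicPt G x) : ¬ IsConicalLimitPt G x := by
  intro hc
  obtain ⟨t, htG, ht, htx⟩ := hx
  obtain ⟨g, hgG, -, a, b, hab, h1, h2⟩ := hc.exists_isConvSeq hG hp
  exact h1.false_of_parabolic hG hp htG ht htx hgG h2 hab

end Parabolic

section Coset

theorem exists_subseq_const {α : Type*} {F : Set α} (hF : F.Finite) {u : ℕ → α}
    (hu : ∀ n, u n ∈ F) : ∃ φ : ℕ → ℕ, StrictMono φ ∧ ∀ n, u (φ n) = u (φ 0) := by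
  obtain ⟨φ, hφ, h | h⟩ := exists_subseq_const_or_injective u
  · exact ⟨φ, hφ, h⟩
  · exact (Set.infinite_of_injective_forall_mem h (fun n => hu (φ n)) hF).elim

theorem eventually_notMem_of_injective {α : Type*} {R : Set α} (hR : R.Finite) {u : ℕ → α}
    (hu : Function.Injective u) : ∀ᶠ n in atTop, u n ∉ R := by
  have := (hR.preimage hu.injOn).eventually_cofinite_notMem
  rwa [Nat.cofinite_eq_atTop] at this

variable [CompactSpace M] [TopologicalSpace.MetrizableSpace M]
  {G J : Subgroup (M ≃ₜ M)} {p : Fin 3 → M} {f : (M ≃ₜ M) → ℕ}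

theorem not_isConicalLimitPt_of_minimal (hG : IsDiscreteConvGroup G)
    (hp : Function.Injective p) (hf : IsPotential G p f) (hJG : J ≤ G) {y : ℕ → M ≃ₜ M}
    (hyG : ∀ n, y n ∈ G) {a r : M} (hy : IsConvSeq y a r)
    (hmin : ∀ n, ∀ j ∈ J, f (y n) ≤ f (j * y n)) : ¬ IsConicalLimitPt J a := by
  intro hc
  obtain ⟨g, hgJ, hinj, a', b, hab, hg, hga⟩ := hc.exists_isConvSeq (hG.mono hJG) hp
  obtain ⟨N, hN, N', hN', R, hR, h⟩ := hf a' b hab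
  obtain ⟨k, hk1, hk2, hk3⟩ := ((eventually_notMem_of_injective hR hinj).and
    ((hg.eventually_maj hp hN').and (hga.eventually_mem (interior_mem_nhds.2 hN)))).exists
  obtain ⟨n, hn⟩ := ((hy.mul_left (g k)).eventually_maj hp
    (mem_interior_iff_mem_nhds.1 hk3)).exists
  have h1 := h _ (hJG (hgJ k)) _ (G.mul_mem (hJG (hgJ k)) (hyG n)) hk1 hk2 hn
  rw [inv_mul_cancel_left] at h1
  exact (h1.trans_le (hmin n _ (hgJ k))).false

theorem eq_of_stabilizer_mul (hG : IsDiscreteConvGroup G) (hp : Function.Injective p)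
    (hf : IsPotential G p f) (hJG : J ≤ G) {t : M ≃ₜ M} (htG : t ∈ G) (ht : IsParabolicElem t)
    {q : M} (htq : t q = q) {y h : ℕ → M ≃ₜ M} (hyG : ∀ n, y n ∈ G) {r p' z' : M}
    (hy : IsConvSeq y q r) (hhJ : ∀ n, h n ∈ J) (hhq : ∀ n, h n q = q)
    (hk : IsConvSeq (fun n => h n * y n) p' z')
    (hmin : ∀ n, ∀ j ∈ J, f (y n) ≤ f (j * y n)) : p' = q := by
  by_contra hpq
  obtain ⟨φ, hφ, ⟨s, hs⟩ | ⟨hinj, b, d, hbd⟩⟩ := hG.exists_subseq h fun n => hJG (hhJ n)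
  · have h1 := hk.comp hφ.tendsto_atTop
    have h2 := (hy.comp hφ.tendsto_atTop).mul_left s
    simp only [Function.comp_def, hs] at h1 h2
    have h3 := h1.attracting_unique hp h2
    rw [← hs 0, hhq] at h3
    exact hpq h3
  · have hlim : Tendsto (fun n => (h ∘ φ) n q) atTop (𝓝 q) := by
      simp only [Function.comp_apply, hhq]
      exact tendsto_const_nhds
    have hbq : b = q := by
      by_contra hbq
      by_cases hd : d = q
      · subst hd
        exact hbd.false_of_parabolic hG hp htG ht htq (fun n => hJG (hhJ _)) hlim (Ne.symm hbq)
      · exact hbq (tendsto_nhds_unique (hbd.tendsto (Ne.symm hd)) hlim)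
    subst hbq
    obtain ⟨N, hN, N', hN', R, hR, hlt⟩ := hf p' b hpq
    obtain ⟨n, hn1, hn2, hn3⟩ := ((eventually_notMem_of_injective hR hinj).and
      ((hbd.eventually_maj hp hN').and
        ((hk.comp hφ.tendsto_atTop).eventually_maj hp hN))).exists
    have h1 := hlt _ (hJG (hhJ _)) _ (G.mul_mem (hJG (hhJ _)) (hyG _)) hn1 hn2 hn3
    rw [inv_mul_cancel_left] at h1
    exact (h1.trans_le (hmin _ _ (hhJ _))).false

theorem false_of_bounded_stabilizer (hG : IsDiscreteConvGroup G) (hp : Function.Injective p)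
    (hf : IsPotential G p f) (hJG : J ≤ G) {t : M ≃ₜ M} (htG : t ∈ G) (ht : IsParabolicElem t)
    {q : M} (htq : t q = q) {K : Set M} (hK : IsCompact K) (hqK : q ∉ K)
    {F : Set (M ≃ₜ M)} (hF : F.Finite)
    (hFJ : ∀ h ∈ G, h q = q → ∃ c ∈ F, ∃ j ∈ J, h = c * j)
    {y : ℕ → M ≃ₜ M} (hyG : ∀ n, y n ∈ G) (hyJ : ∀ m n, y m * (y n)⁻¹ ∈ J → m = n) {r : M}
    (hy : IsConvSeq y q r) {z e : M} (hze : z ≠ e)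
    (hye : Tendsto (fun n => (y n)⁻¹ q) atTop (𝓝 e))
    (hK' : ∀ n, ∃ h ∈ G, h q = q ∧ h (y n z) ∈ K)
    (hmin : ∀ n, ∀ j ∈ J, f (y n) ≤ f (j * y n)) : False := by
  choose h hhG hhq hhK using hK'
  choose c hcF j hjJ hcj using fun n => hFJ (h n) (hhG n) (hhq n)
  obtain ⟨φ, hφ, hc⟩ := exists_subseq_const hF hcF
  let s := h (φ 0)
  let η : ℕ → M ≃ₜ M := fun n => s⁻¹ * h (φ n)
  have hsq : s⁻¹ q = q := by
    conv_lhs => rw [← hhq (φ 0)]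
    exact inv_apply_self s q
  have hηq : ∀ n, η n q = q := fun n => by
    show s⁻¹ (h (φ n) q) = q
    rw [hhq, hsq]
  have hηJ : ∀ n, η n ∈ J := fun n => by
    have : η n = (j (φ 0))⁻¹ * j (φ n) := by
      show (h (φ 0))⁻¹ * h (φ n) = _
      rw [hcj (φ 0), hcj (φ n), hc n]
      group
    rw [this]
    exact J.mul_mem (J.inv_mem (hjJ _)) (hjJ _)
  have hkinj : Function.Injective fun n => η n * y (φ n) := by
    intro m n hmn
    have h1 : y (φ m) * (y (φ n))⁻¹ = (η m)⁻¹ * η n := by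
      rw [eq_inv_mul_iff_mul_eq, ← mul_assoc, mul_inv_eq_iff_eq_mul]
      exact hmn
    exact hφ.injective (hyJ _ _ (h1 ▸ J.mul_mem (J.inv_mem (hηJ m)) (hηJ n)))
  have hkG : ∀ n, η n * y (φ n) ∈ G := fun n => G.mul_mem (hJG (hηJ n)) (hyG _)
  obtain ⟨ψ, hψ, p', z', hk⟩ := hG _ hkG hkinj
  have hφψ := hφ.comp hψ
  have hp' : p' = q := eq_of_stabilizer_mul hG hp hf hJG htG ht htq (fun n => hyG (φ (ψ n)))
    (hy.comp hφψ.tendsto_atTop) (fun n => hηJ (ψ n)) (fun n => hηq _) hk fun n => hmin _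
  subst hp'
  have hKc : IsClosed (s ⁻¹' K) := hK.isClosed.preimage s.continuous
  have hz' : z' = z := by
    by_contra hz
    have := hKc.mem_of_tendsto (hk.tendsto (Ne.symm hz)) (Eventually.of_forall fun n => by
      show s (s⁻¹ (h (φ (ψ n)) (y (φ (ψ n)) z))) ∈ K
      rw [apply_inv_self]
      exact hhK _)
    apply hqK
    have hsp : s p' = p' := hhq _
    rw [← hsp]
    exact this
  subst hz'
  refine hk.inv.false_of_parabolic hG hp htG ht htq (fun n => G.inv_mem (hkG _)) ?_ hze.symm
  refine (hye.comp hφψ.tendsto_atTop).congr fun n => ?_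
  have h1 : (η (ψ n))⁻¹ p' = p' := by
    conv_lhs => rw [← hηq (ψ n)]
    exact inv_apply_self _ _
  simp only [Function.comp_apply, mul_inv_rev]
  rw [mul_apply, h1]

theorem IsFullyQuasiconvex.not_mem_limitSet_of_minimal (hG : IsDiscreteConvGroup G)
    (hGgf : IsGeomFinite G) (hp : Function.Injective p) (hf : IsPotential G p f)
    (hJ : IsFullyQuasiconvex G J) {y : ℕ → M ≃ₜ M} (hyG : ∀ n, y n ∈ G)
    (hyJ : ∀ m n, y m * (y n)⁻¹ ∈ J → m = n) {a r : M} (hy : IsConvSeq y a r)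
    (hmin : ∀ n, ∀ j ∈ J, f (y n) ≤ f (j * y n)) : a ∉ limitSet J := by
  intro ha
  obtain ⟨hJG, hJgf, F, hF, hFJ⟩ := hJ
  rcases hJgf a ha with hc | ⟨⟨t, htJ, ht, hta⟩, -⟩
  · exact not_isConicalLimitPt_of_minimal hG hp hf hJG hyG hy hmin hc
  have htG := hJG htJ
  have hFJ' : ∀ h ∈ G, h a = a → ∃ c ∈ F, ∃ j ∈ J, h = c * j := fun h hh hha =>
    hFJ h hh ⟨a, ⟨a, ha, hha⟩, ha⟩
  have haG := limitSet_mono hJG ha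
  obtain ⟨K, hK, hKsub, hKcov⟩ :=
    ((hGgf a haG).resolve_left (IsParabolicPt.not_isConicalLimitPt hG hp ⟨t, htG, ht, hta⟩)).2
  by_cases htriv : limitSet G ⊆ {a}
  · have hfix : ∀ n, (y n)⁻¹ a = a := fun n =>
      htriv (apply_mem_limitSet (G.inv_mem (hyG n)) haG)
    choose c hcF j hjJ hcj using fun n => hFJ' _ (G.inv_mem (hyG n)) (hfix n)
    obtain ⟨φ, hφ, hc⟩ := exists_subseq_const hF hcF
    have h1 : y (φ 1) * (y (φ 0))⁻¹ = (j (φ 1))⁻¹ * j (φ 0) := by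
      rw [← inv_inv (y (φ 1)), hcj (φ 1), hcj (φ 0), hc 1]
      group
    have := hφ.injective (hyJ _ _ (h1 ▸ J.mul_mem (J.inv_mem (hjJ _)) (hjJ _)))
    omega
  obtain ⟨x, hxG, hxa⟩ := not_subset.1 htriv
  obtain ⟨e, φ, hφ, he⟩ := CompactSpace.tendsto_subseq fun n => (y n)⁻¹ a
  obtain ⟨z, hzG, hze⟩ : ∃ z ∈ limitSet G, z ≠ e := by
    by_cases hea : e = a
    · exact ⟨x, hxG, fun h => hxa (h.trans hea)⟩
    · exact ⟨a, haG, Ne.symm hea⟩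
  obtain ⟨ψ, hψ, hψz⟩ := extraction_of_eventually_atTop
    (he.eventually_mem (isOpen_ne.mem_nhds hze.symm))
  have hφψ := hφ.comp hψ
  refine false_of_bounded_stabilizer hG hp hf hJG htG ht hta hK (fun h => (hKsub h).2 rfl) hF
    hFJ' (y := y ∘ (φ ∘ ψ)) (fun n => hyG _) (fun m n h => hφψ.injective (hyJ _ _ h))
    (hy.comp hφψ.tendsto_atTop) hze (he.comp hψ.tendsto_atTop) (fun n => ?_)
    (fun n => hmin _)
  refine hKcov _ ⟨apply_mem_limitSet (hyG _) hzG, fun h => hψz n ?_⟩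
  have h' : y (φ (ψ n)) z = a := h
  simp only [Function.comp_apply]
  rw [← h', inv_apply_self]

theorem IsFullyQuasiconvex.exists_coset_rep (hG : IsDiscreteConvGroup G)
    (hGgf : IsGeomFinite G) (hp : Function.Injective p) (hJ : IsFullyQuasiconvex G J)
    {g : ℕ → M ≃ₜ M} (hgG : ∀ n, g n ∈ G) (hgJ : ∀ m n, g m * (g n)⁻¹ ∈ J → m = n) :
    ∃ φ : ℕ → ℕ, StrictMono φ ∧ ∃ j : ℕ → M ≃ₜ M, (∀ n, j n ∈ J) ∧
      Function.Injective (fun n => j n * g (φ n)) ∧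
      ∃ a r, IsConvSeq (fun n => j n * g (φ n)) a r ∧ a ∉ limitSet J := by
  obtain ⟨f, hf⟩ := hG.exists_potential hp
  have hmin : ∀ n, ∃ j ∈ J, ∀ i ∈ J, f (j * g n) ≤ f (i * g n) := fun n => by
    obtain ⟨j, hj, hj'⟩ := Nat.sInf_mem (s := (fun i => f (i * g n)) '' (J : Set (M ≃ₜ M)))
      ⟨_, 1, J.one_mem, rfl⟩
    refine ⟨j, hj, fun i hi => ?_⟩
    have h1 : f (j * g n) = _ := hj'
    rw [h1]
    exact Nat.sInf_le ⟨i, hi, rfl⟩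
  choose j hjJ hj using hmin
  have hyG : ∀ n, j n * g n ∈ G := fun n => G.mul_mem (hJ.1 (hjJ n)) (hgG n)
  have hyJ : ∀ m n, (j m * g m) * (j n * g n)⁻¹ ∈ J → m = n := fun m n h => by
    refine hgJ m n ?_
    have h1 : g m * (g n)⁻¹ = (j m)⁻¹ * ((j m * g m) * (j n * g n)⁻¹) * j n := by group
    rw [h1]
    exact J.mul_mem (J.mul_mem (J.inv_mem (hjJ m)) h) (hjJ n)
  have hinj : Function.Injective fun n => j n * g n := fun m n h => hyJ m n (by
    simp only at h
    rw [h, mul_inv_cancel]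
    exact J.one_mem)
  obtain ⟨φ, hφ, a, r, har⟩ := hG _ hyG hinj
  refine ⟨φ, hφ, fun n => j (φ n), fun n => hjJ _, hinj.comp hφ.injective, a, r, har, ?_⟩
  refine hJ.not_mem_limitSet_of_minimal hG hGgf hp hf (fun n => hyG (φ n))
    (fun m n h => hφ.injective (hyJ _ _ h)) har fun n i hi => ?_
  simp only [← mul_assoc]
  exact hj _ _ (J.mul_mem hi (hjJ _))

end Coset

section PingPong

theorem exists_subseq_coset {Γ : Type*} [Group Γ] (J : Subgroup Γ) (u : ℕ → Γ) :
    ∃ φ : ℕ → ℕ, StrictMono φ ∧ ((∀ n, u (φ n) * (u (φ 0))⁻¹ ∈ J) ∨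
      ∀ m n, u (φ m) * (u (φ n))⁻¹ ∈ J → m = n) := by
  have hsymm : ∀ x y, x * y⁻¹ ∈ J → y * x⁻¹ ∈ J := fun x y h => by
    simpa using J.inv_mem h
  have : IsTrans Γ fun x y => x * y⁻¹ ∈ J := ⟨fun x y z h1 h2 => by
    simpa [mul_assoc] using J.mul_mem h1 h2⟩
  obtain ⟨φ, hφ | hφ⟩ := exists_increasing_or_nonincreasing_subseq (fun x y => x * y⁻¹ ∈ J) u
  · refine ⟨φ, φ.strictMono, Or.inl fun n => ?_⟩
    rcases Nat.eq_zero_or_pos n with rfl | hn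
    · rw [mul_inv_cancel]
      exact J.one_mem
    · exact hsymm _ _ (hφ 0 n hn)
  · refine ⟨φ, φ.strictMono, Or.inr fun m n h => ?_⟩
    rcases lt_trichotomy m n with hl | hl | hl
    · exact (hφ m n hl h).elim
    · exact hl
    · exact (hφ n m hl (hsymm _ _ h)).elim

theorem exists_compact_exhaustion [CompactSpace M] [TopologicalSpace.MetrizableSpace M]
    {U : Set M} (hU : IsOpen U) :
    ∃ K : ℕ → Set M, (∀ n, IsCompact (K n) ∧ K n ⊆ U) ∧
      ∀ C, IsCompact C → C ⊆ U → ∀ᶠ n in atTop, C ⊆ K n := by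
  let _ := TopologicalSpace.metrizableSpaceMetric M
  refine ⟨fun n => (Metric.thickening (1 / ((n : ℝ) + 1)) Uᶜ)ᶜ,
    fun n => ⟨Metric.isOpen_thickening.isClosed_compl.isCompact,
      compl_subset_comm.1 (Metric.self_subset_thickening (by positivity) _)⟩, fun C hC hCU => ?_⟩
  obtain ⟨δ, hδ, hdisj⟩ := (disjoint_compl_right_iff_subset.2 hCU).exists_thickenings hC
    hU.isClosed_compl
  obtain ⟨k, hk⟩ := exists_nat_one_div_lt hδ
  filter_upwards [eventually_ge_atTop k] with n hn x hx hxt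
  refine disjoint_left.1 hdisj (Metric.self_subset_thickening hδ _ hx)
    (Metric.thickening_mono ?_ _ hxt)
  exact (Nat.one_div_le_one_div hn).trans hk.le

theorem exists_injective_or_finite (X : Type*) :
    (∃ p : Fin 3 → X, Function.Injective p) ∨ Finite X := by
  by_cases h : Finite X
  · exact Or.inr h
  · rw [not_finite_iff_infinite] at h
    exact Or.inl ⟨fun i => Infinite.natEmbedding X i,
      (Infinite.natEmbedding X).injective.comp Fin.val_injective⟩

theorem image_compl_of_image_eq {g : M ≃ₜ M} {U : Set M} (h : ⇑g '' U = U) :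
    ⇑g '' Uᶜ = Uᶜ := by
  rw [image_compl_eq g.bijective, h]

theorem image_mul (g h : M ≃ₜ M) (S : Set M) : ⇑(g * h) '' S = ⇑g '' (⇑h '' S) :=
  (image_image g h S).symm

variable [CompactSpace M] [TopologicalSpace.MetrizableSpace M] {G : Subgroup (M ≃ₜ M)}
  {p : Fin 3 → M}

/-- If a convergence sequence is modified on the right by elements of a discrete group so that it
stays a convergence sequence whose repelling point is not a limit point of that group, then the
attracting point does not change. -/
theorem IsConvSeq.attracting_eq_of_mul (hG : IsDiscreteConvGroup G)
    (hp : Function.Injective p) {z i : ℕ → M ≃ₜ M} (hi : ∀ n, i n ∈ G) {a r b s : M}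
    (hz : IsConvSeq z a r) (hzi : IsConvSeq (fun n => z n * i n) b s) (hr : r ∉ limitSet G) :
    a = b := by
  obtain ⟨φ, hφ, ⟨t, ht⟩ | ⟨hinj, c, e, hce⟩⟩ := hG.exists_subseq i hi
  · have h1 := (hz.comp hφ.tendsto_atTop).mul_right t
    have h2 := hzi.comp hφ.tendsto_atTop
    simp only [Function.comp_def, ht] at h1 h2
    exact h1.attracting_unique hp h2
  · have hc : c ≠ r := fun h => hr (h ▸ hce.mem_limitSet (fun k => hi (φ k)) hinj)
    obtain ⟨w, hwe, hws⟩ := exists_ne_ne hp e s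
    exact tendsto_nhds_unique
      ((hz.comp hφ.tendsto_atTop).tendsto_of_tendsto (hce.tendsto hwe) hc)
      ((hzi.comp hφ.tendsto_atTop).tendsto hws)

theorem exists_compact_of_injective (hG : IsDiscreteConvGroup G) (hGgf : IsGeomFinite G)
    (hp : Function.Injective p)
    {H J₁ J₂ : Subgroup (M ≃ₜ M)} (hHG : H ≤ G) (hJ₁H : J₁ ≤ H) (hJ₂H : J₂ ≤ H)
    (hqc₁ : IsFullyQuasiconvex G J₁) (hqc₂ : IsFullyQuasiconvex G J₂)
    {U₁ U₂ : Set M} (hU₁ : IsOpen U₁) (hU₂ : IsOpen U₂)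
    (hinv₁ : ∀ j ∈ J₁, ⇑j '' U₁ = U₁) (hinv₂ : ∀ j ∈ J₂, ⇑j '' U₂ = U₂)
    (hlim₁ : limitSet H \ limitSet J₁ ⊆ U₁) (hlim₂ : limitSet H \ limitSet J₂ ⊆ U₂)
    (hpp : ∀ g ∈ H, g ∉ J₂ → ⇑g '' U₂ᶜ ⊆ U₁) :
    ∃ K : Set M, IsCompact K ∧ K ⊆ U₁ ∧
      ∀ g ∈ H, g ∉ J₂ → ∃ j ∈ J₁, ⇑(j * g) '' U₂ᶜ ⊆ K := by
  by_contra! hcon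
  obtain ⟨K, hK, hKex⟩ := exists_compact_exhaustion hU₁
  choose g hgH hgJ hgK using fun n => hcon (K n) (hK n).1 (hK n).2
  have hB : IsCompact U₂ᶜ := hU₂.isClosed_compl.isCompact
  have star : ∀ C, IsCompact C → C ⊆ U₁ → ∀ φ : ℕ → ℕ, StrictMono φ → ∀ j : ℕ → M ≃ₜ M,
      (∀ n, j n ∈ J₁) → (∀ᶠ n in atTop, ⇑(j n * g (φ n)) '' U₂ᶜ ⊆ C) → False := by
    intro C hC hCU φ hφ j hj h
    obtain ⟨n, hn1, hn2⟩ := (h.and (hφ.tendsto_atTop.eventually (hKex C hC hCU))).exists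
    exact hgK _ _ (hj n) (hn1.trans hn2)
  obtain ⟨ψ, hψ, hψJ | hψJ⟩ := exists_subseq_coset J₁ g
  · refine star (⇑(g (ψ 0)) '' U₂ᶜ) (hB.image (g _).continuous) (hpp _ (hgH _) (hgJ _)) ψ hψ
      (fun n => (g (ψ n) * (g (ψ 0))⁻¹)⁻¹) (fun n => J₁.inv_mem (hψJ n))
      (Eventually.of_forall fun n => ?_)
    have : (g (ψ n) * (g (ψ 0))⁻¹)⁻¹ * g (ψ n) = g (ψ 0) := by group
    rw [this]
  obtain ⟨φ, hφ, j, hjJ, hyinj, a, r, hy, ha⟩ :=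
    hqc₁.exists_coset_rep hG hGgf hp (fun n => hHG (hgH (ψ n))) hψJ
  have hθ := hψ.comp hφ
  let y : ℕ → M ≃ₜ M := fun n => j n * g (ψ (φ n))
  have hyH : ∀ n, y n ∈ H := fun n => H.mul_mem (hJ₁H (hjJ n)) (hgH _)
  have haU : a ∈ U₁ := hlim₁ ⟨hy.mem_limitSet hyH hyinj, ha⟩
  have star' : ∀ C, IsCompact C → C ⊆ U₁ → ∀ χ : ℕ → ℕ, StrictMono χ →
      (∀ᶠ n in atTop, ⇑(y (χ n)) '' U₂ᶜ ⊆ C) → False := fun C hC hCU χ hχ h =>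
    star C hC hCU _ (hθ.comp hχ) (fun n => j (χ n)) (fun n => hjJ _) h
  obtain ⟨χ, hχ, hχJ | hχJ⟩ := exists_subseq_coset J₂ fun n => (y n)⁻¹
  · refine star' (⇑(y (χ 0)) '' U₂ᶜ) (hB.image (y _).continuous) ?_ χ hχ
      (Eventually.of_forall fun n => ?_)
    · rw [image_mul, ← hinv₁ _ (hjJ (χ 0))]
      exact image_mono (hpp _ (hgH _) (hgJ _))
    · have h1 : y (χ 0) = y (χ n) * ((y (χ n))⁻¹ * ((y (χ 0))⁻¹)⁻¹) := by group
      rw [h1, image_mul (y (χ n)), image_compl_of_image_eq (hinv₂ _ (hχJ n))]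
  obtain ⟨φ', hφ', i, hiJ, hwinj, r', a', hw, hr'⟩ :=
    hqc₂.exists_coset_rep hG hGgf hp (fun n => G.inv_mem (hHG (hyH (χ n)))) hχJ
  have hr'U : r' ∈ U₂ := hlim₂ ⟨hw.mem_limitSet
    (fun n => H.mul_mem (hJ₂H (hiJ n)) (H.inv_mem (hyH _))) hwinj, hr'⟩
  have hχφ := hχ.comp hφ'
  have hyz : ∀ n, y (χ (φ' n)) = (i n * (y (χ (φ' n)))⁻¹)⁻¹ * i n := fun n => by group
  have haa' : a' = a := by
    refine hw.inv.attracting_eq_of_mul (hG.mono hqc₂.1) hp hiJ (b := a) (s := r) ?_ hr'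
    have h1 := hy.comp hχφ.tendsto_atTop
    refine (congrArg (fun u => IsConvSeq u a r) (funext fun n => ?_)).mp h1
    exact hyz n
  subst haa'
  obtain ⟨N, hN, hNc, hNU⟩ := exists_mem_nhds_isClosed_subset (hU₁.mem_nhds haU)
  refine star' N hNc.isCompact hNU _ hχφ ?_
  filter_upwards [hw.inv _ hB (fun h => h hr'U) N hN] with n hn
  rw [Function.comp_apply, hyz, image_mul, image_compl_of_image_eq (hinv₂ _ (hiJ n))]
  rintro _ ⟨x, hx, rfl⟩
  exact hn x hx

end PingPong

/-- Let `G` be a geometrically finite discrete convergence group acting on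
a compact metrizable space `M`, let `H ≤ G`, and let `J₁, J₂ ≤ H` be fully quasi-convex
subgroups of `G`. Let `U₁, U₂` be open subsets of `M` such that each `U i` is
`J i`-invariant and `Λ(H) ∖ Λ(J i) ⊆ U i`. Suppose `g (M ∖ U₂) ⊆ U₁` for every
`g ∈ H ∖ J₂`. Then there is a compact `K ⊆ U₁` such that for every `g ∈ H ∖ J₂` there is
`j ∈ J₁` with `(j * g) (M ∖ U₂) ⊆ K`. -/
theorem statement_3 {M : Type*} [TopologicalSpace M] [CompactSpace M]
    [TopologicalSpace.MetrizableSpace M]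
    (G : Subgroup (M ≃ₜ M)) (hG : IsDiscreteConvGroup G) (hGgf : IsGeomFinite G)
    (H J₁ J₂ : Subgroup (M ≃ₜ M)) (hHG : H ≤ G) (hJ₁H : J₁ ≤ H) (hJ₂H : J₂ ≤ H)
    (hqc₁ : IsFullyQuasiconvex G J₁) (hqc₂ : IsFullyQuasiconvex G J₂)
    (U₁ U₂ : Set M) (hU₁ : IsOpen U₁) (hU₂ : IsOpen U₂)
    (hinv₁ : ∀ j ∈ J₁, ⇑j '' U₁ = U₁) (hinv₂ : ∀ j ∈ J₂, ⇑j '' U₂ = U₂)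
    (hlim₁ : limitSet H \ limitSet J₁ ⊆ U₁) (hlim₂ : limitSet H \ limitSet J₂ ⊆ U₂)
    (hpp : ∀ g ∈ H, g ∉ J₂ → ⇑g '' U₂ᶜ ⊆ U₁) :
    ∃ K : Set M, IsCompact K ∧ K ⊆ U₁ ∧
      ∀ g ∈ H, g ∉ J₂ → ∃ j ∈ J₁, ⇑(j * g) '' U₂ᶜ ⊆ K := by
  rcases exists_injective_or_finite M with ⟨p, hp⟩ | hfin
  · exact exists_compact_of_injective hG hGgf hp hHG hJ₁H hJ₂H hqc₁ hqc₂ hU₁ hU₂ hinv₁ hinv₂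
      hlim₁ hlim₂ hpp
  · have : Finite (M ≃ₜ M) := Finite.of_injective _ DFunLike.coe_injective
    refine ⟨⋃ g ∈ {g | g ∈ H ∧ g ∉ J₂}, ⇑g '' U₂ᶜ, (toFinite _).isCompact_biUnion fun g _ =>
      hU₂.isClosed_compl.isCompact.image g.continuous, iUnion₂_subset fun g hg => hpp g hg.1 hg.2,
      fun g hg hgJ => ⟨1, J₁.one_mem, ?_⟩⟩
    rw [one_mul]
    exact subset_biUnion_of_mem (u := fun g : M ≃ₜ M => ⇑g '' U₂ᶜ) ⟨hg, hgJ⟩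

end ConvergenceGroups
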